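/- arXiv:1708.01121 — 2 statements merged into one kernel-verified Lean document; each statement's English description precedes it below -/
import Mathlib

section
/- Let H ∈ (0,1/2), ξ > 0, β > 0 and t ∈ (0,1]. Then ∫_0^t F^H(t,s)^{−2} ds ≤ t^{2−2H}/(2H ξ² κ_H²); in particular the function s ↦ 1/F^H(t,s) is square integrable on (0,t). -/
open MeasureTheory Real Set

/-- The constant `κ_H`. -/
noncomputable def kappaH (H : ℝ) : ℝ :=
  Real.sqrt (2 * H * Real.Gamma (3/2 - H) / (Real.Gamma (H + 1/2) * Real.Gamma (2 - 2*H)))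

/-- The Volterra kernel `F^H` of the fractional Ornstein–Uhlenbeck process for `H < 1/2`. -/
noncomputable def FHlow (ξ β H t s : ℝ) : ℝ :=
  ξ * kappaH H * s ^ ((1:ℝ)/2 - H) *
    ((t * (t - s)) ^ (H - 1/2) +
      ∫ u in Set.Ioo s t,
        ((1 - 2*H) / (2*u) + β) * (u * (u - s)) ^ (H - 1/2) * Real.exp (β * (t - u)))

theorem kappaH_pos {H : ℝ} (hH : H ∈ Set.Ioo (0:ℝ) (1/2)) : 0 < kappaH H := by
  obtain ⟨h0, h1⟩ := hH
  have g1 : 0 < Real.Gamma (3/2 - H) := Real.Gamma_pos_of_pos (by linarith)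
  have g2 : 0 < Real.Gamma (H + 1/2) := Real.Gamma_pos_of_pos (by linarith)
  have g3 : 0 < Real.Gamma (2 - 2*H) := Real.Gamma_pos_of_pos (by linarith)
  exact Real.sqrt_pos.2 (by positivity)

theorem measurable_FHlow (ξ β H t : ℝ) : Measurable (FHlow ξ β H t) := by
  have hS : MeasurableSet {p : ℝ × ℝ | p.1 < p.2 ∧ p.2 < t} :=
    (measurableSet_lt measurable_fst measurable_snd).inter
      (measurableSet_lt measurable_snd measurable_const)
  have hg : Measurable fun p : ℝ × ℝ =>
      ((1 - 2*H) / (2*p.2) + β) * (p.2 * (p.2 - p.1)) ^ (H - 1/2) * Real.exp (β * (t - p.2)) := by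
    fun_prop
  have hI : Measurable fun s => ∫ u in Set.Ioo s t,
      ((1 - 2*H) / (2*u) + β) * (u * (u - s)) ^ (H - 1/2) * Real.exp (β * (t - u)) := by
    convert ((hg.indicator hS).stronglyMeasurable.integral_prod_right' (ν := volume)).measurable
      using 2 with s
    rw [← integral_indicator measurableSet_Ioo]
    rfl
  unfold FHlow
  exact ((measurable_id.pow_const _).const_mul _).mul
    (((measurable_const.mul (measurable_const.sub measurable_id)).pow_const _).add hI)

theorem le_FHlow {H ξ β t s : ℝ} (hH : H ∈ Set.Ioo (0:ℝ) (1/2)) (hξ : 0 < ξ) (hβ : 0 < β)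
    (hs : s ∈ Set.Ioo 0 t) :
    ξ * kappaH H * s ^ ((1:ℝ)/2 - H) * (t * t) ^ (H - 1/2) ≤ FHlow ξ β H t s := by
  obtain ⟨hs0, hst⟩ := hs
  obtain ⟨-, hH2⟩ := id hH
  have hκ := kappaH_pos hH
  have ht : 0 < t := hs0.trans hst
  have hint : 0 ≤ ∫ u in Set.Ioo s t,
      ((1 - 2*H) / (2*u) + β) * (u * (u - s)) ^ (H - 1/2) * Real.exp (β * (t - u)) := by
    refine setIntegral_nonneg measurableSet_Ioo fun u hu => ?_
    have hu0 : 0 < u := hs0.trans hu.1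
    have h1 : 0 ≤ 1 - 2*H := by linarith
    have h2 : 0 ≤ u - s := by linarith [hu.1]
    positivity
  have hpow : (t * t) ^ (H - 1/2) ≤ (t * (t - s)) ^ (H - 1/2) :=
    Real.rpow_le_rpow_of_nonpos (mul_pos ht (by linarith))
      (mul_le_mul_of_nonneg_left (by linarith) ht.le) (by linarith)
  exact mul_le_mul_of_nonneg_left (by linarith) (by positivity)

theorem inv_FHlow_sq_le {H ξ β t s : ℝ} (hH : H ∈ Set.Ioo (0:ℝ) (1/2)) (hξ : 0 < ξ) (hβ : 0 < β)
    (hs : s ∈ Set.Ioo 0 t) :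
    ((FHlow ξ β H t s)⁻¹) ^ 2 ≤
      t ^ (2 - 4*H) / (ξ ^ 2 * kappaH H ^ 2) * s ^ (2*H - 1) := by
  have hκ := kappaH_pos hH
  have hs0 : 0 < s := hs.1
  have ht : 0 < t := hs.1.trans hs.2
  have hL : 0 < ξ * kappaH H * s ^ ((1:ℝ)/2 - H) * (t * t) ^ (H - 1/2) := by positivity
  have hle := le_FHlow hH hξ hβ hs
  calc ((FHlow ξ β H t s)⁻¹) ^ 2
      ≤ ((ξ * kappaH H * s ^ ((1:ℝ)/2 - H) * (t * t) ^ (H - 1/2))⁻¹) ^ 2 :=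
        pow_le_pow_left₀ (inv_nonneg.2 (hL.le.trans hle)) (inv_anti₀ hL hle) 2
    _ = t ^ (2 - 4*H) / (ξ ^ 2 * kappaH H ^ 2) * s ^ (2*H - 1) := by
        have e1 : (s ^ ((1:ℝ)/2 - H)) ^ 2 = (s ^ (2*H - 1))⁻¹ := by
          rw [← Real.rpow_neg hs0.le, ← Real.rpow_mul_natCast hs0.le]
          congr 1
          push_cast
          ring
        have e2 : ((t * t) ^ (H - 1/2)) ^ 2 = (t ^ (2 - 4*H))⁻¹ := by
          rw [← Real.rpow_neg ht.le, Real.mul_rpow ht.le ht.le, ← Real.rpow_add ht,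
            ← Real.rpow_mul_natCast ht.le]
          congr 1
          push_cast
          ring
        rw [inv_pow, mul_pow, mul_pow, mul_pow, e1, e2]
        simp only [mul_inv, inv_inv, div_eq_mul_inv]
        ring

theorem stmt5 (H ξ β t : ℝ) (hH : H ∈ Set.Ioo (0:ℝ) (1/2)) (hξ : 0 < ξ) (hβ : 0 < β)
    (ht : t ∈ Set.Ioc (0:ℝ) 1) :
    MeasureTheory.IntegrableOn (fun s => ((FHlow ξ β H t s)⁻¹) ^ 2) (Set.Ioo 0 t) ∧
    (∫ s in Set.Ioo (0:ℝ) t, ((FHlow ξ β H t s)⁻¹) ^ 2) ≤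
      t ^ (2 - 2*H) / (2 * H * ξ ^ 2 * (kappaH H) ^ 2) := by
  have ht0 : 0 < t := ht.1
  have hH0 : 0 < H := hH.1
  have hκ := kappaH_pos hH
  have hexp : -1 < 2*H - 1 := by linarith
  have hbound : IntegrableOn
      (fun s => t ^ (2 - 4*H) / (ξ ^ 2 * kappaH H ^ 2) * s ^ (2*H - 1)) (Set.Ioo 0 t) :=
    ((intervalIntegral.integrableOn_Ioo_rpow_iff ht0).2 hexp).const_mul _
  have hint : IntegrableOn (fun s => ((FHlow ξ β H t s)⁻¹) ^ 2) (Set.Ioo 0 t) := by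
    refine hbound.mono' ((measurable_FHlow ξ β H t).inv.pow_const 2).aestronglyMeasurable ?_
    filter_upwards [ae_restrict_mem measurableSet_Ioo] with s hs
    rw [Real.norm_of_nonneg (sq_nonneg _)]
    exact inv_FHlow_sq_le hH hξ hβ hs
  refine ⟨hint, (setIntegral_mono_on hint hbound measurableSet_Ioo
    fun s hs => inv_FHlow_sq_le hH hξ hβ hs).trans_eq ?_⟩
  rw [integral_const_mul, ← integral_Ioc_eq_integral_Ioo,
    ← intervalIntegral.integral_of_le ht0.le, integral_rpow (Or.inl hexp)]
  have e : t ^ (2 - 2*H) = t ^ (2 - 4*H) * t ^ (2*H) := by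
    rw [← Real.rpow_add ht0]
    congr 1
    ring
  rw [sub_add_cancel, Real.zero_rpow (by positivity), e]
  field_simp
  simp
end

section
/- Let H ∈ (1/2,1), ξ > 0, β < 0, ε > 0 and 0 < s < t. Then (G^H_ε(t,s) − G^H_0(t,s))² ≤ κ_H² ξ² s^{1−2H} (t(t−s))^{2H−1}. -/
open MeasureTheory Real Set

/-- The rescaled Volterra kernel `G^H_ε` of the fractional Ornstein–Uhlenbeck process. -/
noncomputable def Geps (ξ β H ε t s : ℝ) : ℝ :=
  if H < 1/2 then
    ξ * kappaH H * s ^ ((1:ℝ)/2 - H) *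
      ((t * (t - s)) ^ (H - 1/2) +
        ∫ u in Set.Ioo s t,
          ((1 - 2*H) / (2*u) + β * ε ^ 2) * (u * (u - s)) ^ (H - 1/2) *
            Real.exp (β * ε ^ 2 * (t - u)))
  else if H = 1/2 then ξ * Real.exp (β * ε ^ 2 * (t - s))
  else
    ξ * kappaH H * (H - 1/2) * s ^ ((1:ℝ)/2 - H) *
      ∫ u in Set.Ioo s t, u ^ (H - 1/2) * (u - s) ^ (H - 3/2) * Real.exp (β * ε ^ 2 * (t - u))

/-- The limiting Volterra kernel `G^H_0`. -/
noncomputable def Gzero (ξ H t s : ℝ) : ℝ :=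
  if H < 1/2 then
    ξ * kappaH H * s ^ ((1:ℝ)/2 - H) *
      ((t * (t - s)) ^ (H - 1/2) -
        (H - 1/2) * ∫ u in Set.Ioo s t, (u - s) ^ (H - 1/2) * u ^ (H - 3/2))
  else if H = 1/2 then ξ
  else
    ξ * kappaH H * (H - 1/2) * s ^ ((1:ℝ)/2 - H) *
      ∫ u in Set.Ioo s t, u ^ (H - 1/2) * (u - s) ^ (H - 3/2)

/-- The shifted power `(u - s) ^ (a - 1)` is integrable on `(s, t)` for `a > 0`. -/
lemma integrableOn_sub_rpow {a s t : ℝ} (ha : 0 < a) (hst : s ≤ t) :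
    IntegrableOn (fun u : ℝ => (u - s) ^ (a - 1)) (Ioo s t) := by
  have h := (intervalIntegral.intervalIntegrable_rpow' (a := 0) (b := t - s)
    (r := a - 1) (by linarith)).comp_sub_right s
  simp only [zero_add, sub_add_cancel] at h
  exact ((intervalIntegrable_iff_integrableOn_Ioc_of_le hst).1 h).mono_set Ioo_subset_Ioc_self

lemma integral_sub_rpow {a s t : ℝ} (ha : 0 < a) (hst : s ≤ t) :
    ∫ u in Ioo s t, (u - s) ^ (a - 1) = (t - s) ^ a / a := by
  rw [← integral_Ioc_eq_integral_Ioo, ← intervalIntegral.integral_of_le hst,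
    intervalIntegral.integral_comp_sub_right (fun x : ℝ => x ^ (a - 1)) s,
    integral_rpow (Or.inl (by linarith))]
  simp [Real.zero_rpow ha.ne']

lemma rpow_mul_sub_rpow_le {a s t u : ℝ} (ha : 0 ≤ a) (hs : 0 ≤ s) (hu : u ∈ Ioo s t) :
    u ^ a * (u - s) ^ (a - 1) ≤ t ^ a * (u - s) ^ (a - 1) :=
  mul_le_mul_of_nonneg_right (Real.rpow_le_rpow (hs.trans hu.1.le) hu.2.le ha)
    (Real.rpow_nonneg (sub_nonneg.2 hu.1.le) _)

lemma integrableOn_rpow_mul_sub_rpow {a s t : ℝ} (ha : 0 < a) (hs : 0 ≤ s) (hst : s ≤ t) :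
    IntegrableOn (fun u : ℝ => u ^ a * (u - s) ^ (a - 1)) (Ioo s t) := by
  refine Integrable.mono' ((integrableOn_sub_rpow ha hst).const_mul (t ^ a))
    (by fun_prop) ?_
  refine (ae_restrict_mem measurableSet_Ioo).mono fun u hu => ?_
  rw [Real.norm_of_nonneg (mul_nonneg (Real.rpow_nonneg (hs.trans hu.1.le) _)
    (Real.rpow_nonneg (sub_nonneg.2 hu.1.le) _))]
  exact rpow_mul_sub_rpow_le ha.le hs hu

lemma integral_rpow_mul_sub_rpow_le {a s t : ℝ} (ha : 0 < a) (hs : 0 ≤ s) (hst : s ≤ t) :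
    ∫ u in Ioo s t, u ^ a * (u - s) ^ (a - 1) ≤ (t * (t - s)) ^ a / a := by
  calc ∫ u in Ioo s t, u ^ a * (u - s) ^ (a - 1)
      ≤ ∫ u in Ioo s t, t ^ a * (u - s) ^ (a - 1) :=
        setIntegral_mono_on (integrableOn_rpow_mul_sub_rpow ha hs hst)
          ((integrableOn_sub_rpow ha hst).const_mul _) measurableSet_Ioo
          fun u hu => rpow_mul_sub_rpow_le ha.le hs hu
    _ = (t * (t - s)) ^ a / a := by
        rw [integral_const_mul, integral_sub_rpow ha hst,
          Real.mul_rpow (hs.trans hst) (sub_nonneg.2 hst), mul_div_assoc]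

/-- Damping the integrand by `exp (c (t - u))` with `c ≤ 0` leaves the integral nonnegative and
does not increase it. -/
lemma integral_mul_exp_mem_Icc {a c s t : ℝ} (ha : 0 < a) (hc : c ≤ 0) (hs : 0 ≤ s)
    (hst : s ≤ t) :
    ∫ u in Ioo s t, u ^ a * (u - s) ^ (a - 1) * Real.exp (c * (t - u)) ∈
      Icc 0 (∫ u in Ioo s t, u ^ a * (u - s) ^ (a - 1)) := by
  have hnn : ∀ u ∈ Ioo s t, 0 ≤ u ^ a * (u - s) ^ (a - 1) := fun u hu =>
    mul_nonneg (Real.rpow_nonneg (hs.trans hu.1.le) _)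
      (Real.rpow_nonneg (sub_nonneg.2 hu.1.le) _)
  refine ⟨setIntegral_nonneg measurableSet_Ioo fun u hu =>
    mul_nonneg (hnn u hu) (Real.exp_pos _).le, ?_⟩
  refine integral_mono_of_nonneg ?_ (integrableOn_rpow_mul_sub_rpow ha hs hst) ?_
  · exact (ae_restrict_mem measurableSet_Ioo).mono fun u hu =>
      mul_nonneg (hnn u hu) (Real.exp_pos _).le
  · exact (ae_restrict_mem measurableSet_Ioo).mono fun u hu =>
      mul_le_of_le_one_right (hnn u hu) (Real.exp_le_one_iff.2
        (mul_nonpos_of_nonpos_of_nonneg hc (sub_nonneg.2 hu.2.le)))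

theorem stmt12 (H ξ β ε t s : ℝ) (hH : H ∈ Set.Ioo (1/2:ℝ) 1) (hξ : 0 < ξ) (hβ : β < 0)
    (hε : 0 < ε) (hs : 0 < s) (hst : s < t) :
    (Geps ξ β H ε t s - Gzero ξ H t s) ^ 2 ≤
      (kappaH H) ^ 2 * ξ ^ 2 * s ^ (1 - 2*H) * (t * (t - s)) ^ (2*H - 1) := by
  obtain ⟨hH, -⟩ := hH
  have ha : 0 < H - 1/2 := by linarith
  have hc : β * ε ^ 2 ≤ 0 := mul_nonpos_of_nonpos_of_nonneg hβ.le (sq_nonneg ε)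
  have hts : 0 ≤ t * (t - s) := mul_nonneg (hs.trans hst).le (sub_nonneg.2 hst.le)
  obtain ⟨hA, hAB⟩ := integral_mul_exp_mem_Icc ha hc hs.le hst.le
  have hB := integral_rpow_mul_sub_rpow_le ha hs.le hst.le
  rw [le_div_iff₀ ha] at hB
  have he : H - 1/2 - 1 = H - 3/2 := by ring
  rw [he] at hA hAB hB
  simp only [Geps, Gzero, if_neg hH.not_gt, if_neg hH.ne']
  set A := ∫ u in Ioo s t, u ^ (H - 1/2) * (u - s) ^ (H - 3/2) * Real.exp (β * ε ^ 2 * (t - u))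
  set B := ∫ u in Ioo s t, u ^ (H - 1/2) * (u - s) ^ (H - 3/2)
  have hs2 : s ^ (1 - 2*H) = (s ^ ((1:ℝ)/2 - H)) ^ 2 := by
    rw [← Real.rpow_mul_natCast hs.le]
    congr 1
    push_cast
    ring
  have ht2 : (t * (t - s)) ^ (2*H - 1) = ((t * (t - s)) ^ (H - 1/2)) ^ 2 := by
    rw [← Real.rpow_mul_natCast hts]
    congr 1
    push_cast
    ring
  have hsq : ((H - 1/2) * (B - A)) ^ 2 ≤ ((t * (t - s)) ^ (H - 1/2)) ^ 2 := by
    refine pow_le_pow_left₀ (mul_nonneg ha.le (sub_nonneg.2 hAB)) ?_ 2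
    nlinarith [mul_nonneg ha.le hA]
  rw [hs2, ht2]
  calc _ = (kappaH H ^ 2 * ξ ^ 2 * (s ^ ((1:ℝ)/2 - H)) ^ 2) * ((H - 1/2) * (B - A)) ^ 2 := by ring
    _ ≤ _ := mul_le_mul_of_nonneg_left hsq (by positivity)
end
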